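/- A residuated lattice A satisfies property (★) if and only if for every a ∈ A there exists e ∈ B(A) such that a ⊙ e is nilpotent and a ∨ e ∈ Rad(A). -/

import Mathlib

/-- A (commutative integral bounded) residuated lattice: a bounded lattice together
with a commutative monoid structure (whose unit is the top element) and a residuum
operation satisfying the law of residuation. -/
class ResiduatedLattice (A : Type*) extends Lattice A, BoundedOrder A, CommMonoid A where
  rimp : A → A → A
  residuation : ∀ a b c : A, a ≤ rimp b c ↔ a * b ≤ c
  one_eq_top : (1 : A) = ⊤

namespace ResiduatedLattice

variable {A : Type*} [ResiduatedLattice A]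

/-- Negation: ¬a = a → 0. -/
def rneg (a : A) : A := rimp a ⊥

/-- Biresiduum: d(a,b) = (a → b) ∧ (b → a). -/
def bires (a b : A) : A := rimp a b ⊓ rimp b a

/-- Membership in the Boolean center B(A): complemented elements of the bounded lattice. -/
def IsBoolElem (e : A) : Prop := ∃ f : A, e ⊔ f = ⊤ ∧ e ⊓ f = ⊥

/-- A filter of a residuated lattice. -/
def IsRLFilter (F : Set A) : Prop :=
  F.Nonempty ∧ (∀ a b : A, a ∈ F → b ∈ F → a * b ∈ F) ∧ (∀ a b : A, a ∈ F → a ≤ b → b ∈ F)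

/-- The principal filter [x) = {a | xⁿ ≤ a for some n ≥ 1}. -/
def princ (x : A) : Set A := {a : A | ∃ n : ℕ, 1 ≤ n ∧ x ^ n ≤ a}

/-- A filter F has the Boolean Lifting Property. -/
def HasBLP (F : Set A) : Prop :=
  ∀ a : A, a ⊔ rneg a ∈ F → ∃ e : A, IsBoolElem e ∧ bires a e ∈ F

/-- A filter F has the Idempotent Lifting Property. -/
def HasILP (F : Set A) : Prop :=
  ∀ a : A, bires a (a * a) ∈ F → ∃ e : A, e * e = e ∧ bires a e ∈ F

/-- A proper filter. -/
def IsProperRLFilter (F : Set A) : Prop := IsRLFilter F ∧ F ≠ Set.univ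

/-- A maximal filter: a proper filter maximal under inclusion among proper filters. -/
def IsMaxRLFilter (M : Set A) : Prop :=
  IsProperRLFilter M ∧ ∀ G : Set A, IsProperRLFilter G → M ⊆ G → G = M

/-- A prime filter: a proper filter P with a ∨ b ∈ P → a ∈ P or b ∈ P. -/
def IsPrimeRLFilter (P : Set A) : Prop :=
  IsProperRLFilter P ∧ ∀ a b : A, a ⊔ b ∈ P → a ∈ P ∨ b ∈ P

/-- The radical: intersection of all maximal filters. -/
def rad (A : Type*) [ResiduatedLattice A] : Set A :=
  {a : A | ∀ M : Set A, IsMaxRLFilter M → a ∈ M}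

/-- v(a) = set of maximal filters containing a. -/
def vset (a : A) : Set (Set A) := {M : Set A | IsMaxRLFilter M ∧ a ∈ M}

/-- d(a) = set of maximal filters not containing a. -/
def dset (a : A) : Set (Set A) := {M : Set A | IsMaxRLFilter M ∧ a ∉ M}

/-- An element is nilpotent iff some positive power of it is 0. -/
def RLNilpotent (a : A) : Prop := ∃ n : ℕ, 1 ≤ n ∧ a ^ n = ⊥

/-- The join F ∨ G of two filters: the smallest filter including F ∪ G. -/
def filtJoin (F G : Set A) : Set A := ⋂₀ {H : Set A | IsRLFilter H ∧ F ∪ G ⊆ H}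

end ResiduatedLattice

namespace ResiduatedLattice

variable {A : Type*} [ResiduatedLattice A]

lemma aux_mono_left {a b : A} (c : A) (h : a ≤ b) : a * c ≤ b * c := by
  rw [← residuation]
  exact h.trans ((residuation _ _ _).2 le_rfl)

lemma aux_mono {a b c d : A} (h : a ≤ b) (h' : c ≤ d) : a * c ≤ b * d := by
  refine (aux_mono_left c h).trans ?_
  rw [mul_comm b c, mul_comm b d]
  exact aux_mono_left b h'

lemma aux_le_one (a : A) : a ≤ 1 := by
  rw [one_eq_top]; exact le_top

lemma aux_mul_le_left (a b : A) : a * b ≤ a := by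
  simpa using aux_mono (le_refl a) (aux_le_one b)

lemma aux_mul_le_right (a b : A) : a * b ≤ b := by
  rw [mul_comm]; exact aux_mul_le_left b a

lemma aux_sup_mul_le {a b c d : A} (h1 : a * c ≤ d) (h2 : b * c ≤ d) : (a ⊔ b) * c ≤ d := by
  rw [← residuation] at *
  exact sup_le h1 h2

lemma aux_pow_mono {a b : A} (h : a ≤ b) (n : ℕ) : a ^ n ≤ b ^ n := by
  induction n with
  | zero => simp
  | succ k ih => rw [pow_succ, pow_succ]; exact aux_mono ih h

lemma aux_compl_mul {e f : A} (h : e ⊓ f = ⊥) : e * f = ⊥ :=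
  le_bot_iff.1 (h ▸ le_inf (aux_mul_le_left e f) (aux_mul_le_right e f))

/-- If `e ∨ f = 1` and `m * e = 0` then `m ≤ f`. -/
lemma aux_le_of_mul {e f m : A} (h : e ⊔ f = ⊤) (hm : m * e = ⊥) : m ≤ f := by
  have h1 : (e ⊔ f) * m ≤ f :=
    aux_sup_mul_le (by rw [mul_comm, hm]; exact bot_le) (aux_mul_le_left f m)
  rwa [h, ← one_eq_top, one_mul] at h1

lemma aux_idem {e f : A} (h : e ⊔ f = ⊤) (h' : e ⊓ f = ⊥) : e * e = e := by
  apply le_antisymm (aux_mul_le_left e e)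
  have h1 : (e ⊔ f) * e ≤ e * e :=
    aux_sup_mul_le le_rfl (by rw [mul_comm, aux_compl_mul h']; exact bot_le)
  rwa [h, ← one_eq_top, one_mul] at h1

lemma aux_mem_princ (x : A) : x ∈ princ x := ⟨1, le_rfl, by simp⟩

lemma aux_pow_mem {F : Set A} (hF : IsRLFilter F) {x : A} (hx : x ∈ F) (n : ℕ) :
    x ^ n ∈ F := by
  induction n with
  | zero => rw [pow_zero]; exact hF.2.2 _ _ hx (aux_le_one x)
  | succ k ih => rw [pow_succ]; exact hF.2.1 _ _ ih hx

lemma aux_princ_subset {F : Set A} (hF : IsRLFilter F) {x : A} (hx : x ∈ F) :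
    princ x ⊆ F := by
  rintro a ⟨n, _, h⟩
  exact hF.2.2 _ _ (aux_pow_mem hF hx n) h

lemma aux_princ_filter (x : A) : IsRLFilter (princ x) := by
  refine ⟨⟨x, aux_mem_princ x⟩, ?_, ?_⟩
  · rintro a b ⟨n, hn, h⟩ ⟨k, _, h'⟩
    exact ⟨n + k, by omega, by rw [pow_add]; exact aux_mono h h'⟩
  · rintro a b ⟨n, hn, h⟩ hab
    exact ⟨n, hn, h.trans hab⟩

lemma aux_max {M : Set A} (hM : IsMaxRLFilter M) {e f : A} (h : e ⊔ f = ⊤)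
    (h' : e ⊓ f = ⊥) (he : e ∉ M) : f ∈ M := by
  have hF := hM.1.1
  by_contra hf
  have hG : IsRLFilter {a : A | ∃ m ∈ M, m * e ≤ a} := by
    obtain ⟨m0, hm0⟩ := hF.1
    refine ⟨⟨m0 * e, m0, hm0, le_rfl⟩, ?_, ?_⟩
    · rintro a b ⟨m, hm, h1⟩ ⟨k, hk, h2⟩
      refine ⟨m * k, hF.2.1 _ _ hm hk, ?_⟩
      rw [← aux_idem h h', mul_mul_mul_comm]
      exact aux_mono h1 h2
    · rintro a b ⟨m, hm, h1⟩ hab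
      exact ⟨m, hm, h1.trans hab⟩
  have hprop : {a : A | ∃ m ∈ M, m * e ≤ a} ≠ Set.univ := by
    intro hu
    have hb : (⊥ : A) ∈ {a : A | ∃ m ∈ M, m * e ≤ a} := by rw [hu]; trivial
    obtain ⟨m, hm, h1⟩ := hb
    exact hf (hF.2.2 _ _ hm (aux_le_of_mul h (le_bot_iff.1 h1)))
  have heq := hM.2 _ ⟨hG, hprop⟩ (fun m hm => ⟨m, hm, aux_mul_le_left m e⟩)
  apply he
  rw [← heq]
  obtain ⟨m0, hm0⟩ := hF.1
  exact ⟨m0, hm0, aux_mul_le_right m0 e⟩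

end ResiduatedLattice

open ResiduatedLattice in
theorem stmt_13 {A : Type*} [ResiduatedLattice A] :
    (∀ x : A, ∃ u e : A, u ∈ rad A ∧ IsBoolElem e ∧
        princ x = filtJoin (princ u) (princ e)) ↔
      (∀ a : A, ∃ e : A, IsBoolElem e ∧ RLNilpotent (a * e) ∧ a ⊔ e ∈ rad A) := by
  constructor
  · intro H a
    obtain ⟨u, e, hu, ⟨f, h, h'⟩, heq⟩ := H a
    refine ⟨f, ⟨e, by rw [sup_comm, h], by rw [inf_comm, h']⟩, ?_, ?_⟩
    · have he : e ∈ princ a := by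
        rw [heq]
        rintro K ⟨_, hK⟩
        exact hK (Or.inr (aux_mem_princ e))
      obtain ⟨n, hn, hne⟩ := he
      refine ⟨n, hn, le_bot_iff.1 ?_⟩
      rw [← aux_compl_mul h', mul_pow]
      refine aux_mono hne ?_
      obtain ⟨k, rfl⟩ : ∃ k, n = k + 1 := ⟨n - 1, by omega⟩
      rw [pow_succ]
      exact aux_mul_le_right _ _
    · intro M hM
      have hF := hM.1.1
      by_cases he : e ∈ M
      · have ha : a ∈ filtJoin (princ u) (princ e) := heq ▸ aux_mem_princ a
        exact hF.2.2 _ _ (ha M ⟨hF, Set.union_subset (aux_princ_subset hF (hu M hM))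
          (aux_princ_subset hF he)⟩) le_sup_left
      · exact hF.2.2 _ _ (aux_max hM h h' he) le_sup_right
  · intro H x
    obtain ⟨e, ⟨f, h, h'⟩, ⟨n, hn, hnil⟩, hrad⟩ := H x
    refine ⟨x ⊔ e, f, hrad, ⟨e, by rw [sup_comm, h], by rw [inf_comm, h']⟩, ?_⟩
    have hen : e ^ n = e := by
      clear hnil
      induction n, hn using Nat.le_induction with
      | base => simp
      | succ k _ ih => rw [pow_succ, ih, aux_idem h h']
    apply Set.Subset.antisymm
    · rintro y hy K ⟨hK, hsub⟩
      have h1 : x ⊔ e ∈ K := hsub (Or.inl (aux_mem_princ _))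
      have h2 : f ∈ K := hsub (Or.inr (aux_mem_princ _))
      refine aux_princ_subset hK (hK.2.2 _ _ (hK.2.1 _ _ h1 h2) ?_) hy
      exact aux_sup_mul_le (aux_mul_le_left _ _) (by rw [aux_compl_mul h']; exact bot_le)
    · intro y hy
      refine hy _ ⟨aux_princ_filter x, Set.union_subset
        (aux_princ_subset (aux_princ_filter x) ?_) (aux_princ_subset (aux_princ_filter x) ?_)⟩
      · exact (aux_princ_filter x).2.2 _ _ (aux_mem_princ x) le_sup_left
      · refine ⟨n, hn, aux_le_of_mul h ?_⟩
        rw [mul_pow, hen] at hnil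
        exact hnil
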